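/- Let (X,d) be a cone metric space over a Banach algebra A with solid cone P, let X_n (n ∈ ℕ) and X_∞ be nonempty subsets of X, and let T_n : X_n → X and T_∞ : X_∞ → X be maps such that: (i) the family (T_n) has property (G) with (G)-limit T_∞; (ii) each T_n is a k-contraction w.r.t. d for a common k ∈ P with ρ(k) < 1; (iii) each T_n has a fixed point x_n. Then T_∞ has a fixed point x_∞ ∈ X_∞ if and only if the sequence (x_n) converges to some point y ∈ X_∞, i.e. there exists y ∈ X_∞ such that (d(x_n,y))_{n∈ℕ} is a c-sequence. -/

import Mathlib

open Filter Topology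

/-- Spectral radius via the Gelfand formula: `inf_{n ≥ 1} ‖k ^ n‖ ^ (1 / n)`. -/
noncomputable def specRad {A : Type*} [NormedRing A] (k : A) : ℝ :=
  ⨅ n : ℕ, ‖k ^ (n + 1)‖ ^ ((1 : ℝ) / (n + 1))

/-- A cone in a real Banach algebra `A`: a nonempty closed subset containing `0` and `1`,
closed under nonnegative real combinations and multiplication, with `P ∩ (-P) = {0}`. -/
structure IsCone {A : Type*} [NormedRing A] [NormedAlgebra ℝ A] (P : Set A) : Prop where
  closed : IsClosed P
  zero_mem : (0 : A) ∈ P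
  one_mem : (1 : A) ∈ P
  smul_mem : ∀ a : ℝ, 0 ≤ a → ∀ x ∈ P, a • x ∈ P
  add_mem : ∀ x ∈ P, ∀ y ∈ P, x + y ∈ P
  mul_mem : ∀ x ∈ P, ∀ y ∈ P, x * y ∈ P
  antisymm : ∀ x ∈ P, -x ∈ P → x = 0

/-- A c-sequence with respect to the solid cone `P`: for every `c ≫ 0` eventually `u n ≪ c`. -/
def CSeq {A : Type*} [NormedRing A] [NormedAlgebra ℝ A] (P : Set A) (u : ℕ → A) : Prop :=
  ∀ c : A, c ∈ interior P → ∃ N : ℕ, ∀ n ≥ N, c - u n ∈ interior P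

/-- A cone metric on `X` over the Banach algebra `A` with cone `P`. -/
structure IsConeMetric {A : Type*} [NormedRing A] [NormedAlgebra ℝ A] (P : Set A)
    {X : Type*} (d : X → X → A) : Prop where
  mem_cone : ∀ x y, d x y ∈ P
  eq_zero_iff : ∀ x y, d x y = 0 ↔ x = y
  symm : ∀ x y, d x y = d y x
  triangle : ∀ x y z, d x y + d y z - d x z ∈ P

/-- Completeness of a cone metric space over a Banach algebra:
every Cauchy sequence converges (in the c-sequence sense). -/
def ConeComplete {A : Type*} [NormedRing A] [NormedAlgebra ℝ A] (P : Set A)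
    {X : Type*} (d : X → X → A) : Prop :=
  ∀ u : ℕ → X,
    (∀ c : A, c ∈ interior P → ∃ N : ℕ, ∀ m ≥ N, ∀ n ≥ N, c - d (u m) (u n) ∈ interior P) →
    ∃ x : X, CSeq P fun n => d (u n) x

/-- `Tinf` is a (G)-limit of the family `T` (property (G)). -/
def GLimit {A : Type*} [NormedRing A] [NormedAlgebra ℝ A] (P : Set A)
    {X : Type*} (d : X → X → A) (Xn : ℕ → Set X) (Xinf : Set X)
    (T : ℕ → X → X) (Tinf : X → X) : Prop :=
  ∀ x ∈ Xinf, ∃ u : ℕ → X, (∀ n, u n ∈ Xn n) ∧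
    CSeq P (fun n => d (u n) x) ∧ CSeq P (fun n => d (T n (u n)) (Tinf x))

/-- `Tinf` is an (H)-limit of the family `T` (property (H)). -/
def HLimit {A : Type*} [NormedRing A] [NormedAlgebra ℝ A] (P : Set A)
    {X : Type*} (d : X → X → A) (Xn : ℕ → Set X) (Xinf : Set X)
    (T : ℕ → X → X) (Tinf : X → X) : Prop :=
  ∀ u : ℕ → X, (∀ n, u n ∈ Xn n) → ∃ v : ℕ → X, (∀ n, v n ∈ Xinf) ∧
    CSeq P (fun n => d (u n) (v n)) ∧ CSeq P (fun n => d (T n (u n)) (Tinf (v n)))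

lemma exists_norm_pow_lt_one_of_specRad_lt_one {A : Type*} [NormedRing A] {k : A}
    (hk : specRad k < 1) :
    ∃ m : ℕ, ‖k ^ m‖ < 1 := by
  obtain ⟨n, hn⟩ := exists_lt_of_ciInf_lt hk
  refine ⟨n + 1, lt_of_not_ge fun h => hn.not_ge ?_⟩
  exact Real.one_le_rpow h (by positivity)

section ConeLemmas

variable {A : Type*} [NormedRing A] [NormedAlgebra ℝ A] {P : Set A}

lemma IsCone.add_mem_interior (hP : IsCone P) {a b : A} (ha : a ∈ interior P) (hb : b ∈ P) :
    a + b ∈ interior P := by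
  have hsub : (fun z => z - b) ⁻¹' interior P ⊆ P := fun z hz => by
    simpa using hP.add_mem _ (interior_subset hz) _ hb
  refine interior_maximal hsub (isOpen_interior.preimage (by fun_prop)) ?_
  simpa using ha

lemma IsCone.smul_mem_interior (hP : IsCone P) {r : ℝ} (hr : 0 < r) {a : A}
    (ha : a ∈ interior P) : r • a ∈ interior P := by
  have hsub : (fun z => r⁻¹ • z) ⁻¹' interior P ⊆ P := fun z hz => by
    simpa [smul_smul, hr.ne'] using hP.smul_mem r hr.le _ (interior_subset hz)
  refine interior_maximal hsub (isOpen_interior.preimage (by fun_prop)) ?_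
  simpa [smul_smul, hr.ne'] using ha

lemma exists_pos_sub_smul_mem_interior {c : A} (hc : c ∈ interior P) (a : A) :
    ∃ r : ℝ, 0 < r ∧ c - r • a ∈ interior P := by
  have hcont : Continuous fun r : ℝ => c - r • a := by fun_prop
  have hmem : ∀ᶠ r in 𝓝 (0 : ℝ), c - r • a ∈ interior P :=
    hcont.continuousAt.eventually_mem (isOpen_interior.mem_nhds (by simpa using hc))
  obtain ⟨r, hr, hpos⟩ :=
    ((hmem.filter_mono nhdsWithin_le_nhds).and (self_mem_nhdsWithin (s := Set.Ioi 0))).exists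
  exact ⟨r, hpos, hr⟩

lemma CSeq.of_le (hP : IsCone P) {u v : ℕ → A} (hu : CSeq P u) (h : ∀ n, u n - v n ∈ P) :
    CSeq P v := fun c hc => by
  obtain ⟨N, hN⟩ := hu c hc
  exact ⟨N, fun n hn => by simpa using hP.add_mem_interior (hN n hn) (h n)⟩

lemma CSeq.add (hP : IsCone P) {u v : ℕ → A} (hu : CSeq P u) (hv : CSeq P v) :
    CSeq P fun n => u n + v n := fun c hc => by
  have hhalf := hP.smul_mem_interior (r := 1 / 2) (by norm_num) hc
  obtain ⟨N, hN⟩ := hu _ hhalf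
  obtain ⟨M, hM⟩ := hv _ hhalf
  refine ⟨max N M, fun n hn => ?_⟩
  have h := hP.add_mem_interior (hN n (le_of_max_le_left hn))
    (interior_subset (hM n (le_of_max_le_right hn)))
  convert h using 1
  module

lemma CSeq.const_mul (hP : IsCone P) (hsolid : (interior P).Nonempty) {a : A} (ha : a ∈ P)
    {u : ℕ → A} (hu : CSeq P u) : CSeq P fun n => a * u n := fun c hc => by
  obtain ⟨e, he⟩ := hsolid
  obtain ⟨r, hr, hmem⟩ := exists_pos_sub_smul_mem_interior hc (a * e)
  obtain ⟨N, hN⟩ := hu _ (hP.smul_mem_interior hr he)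
  refine ⟨N, fun n hn => ?_⟩
  have h := hP.add_mem_interior hmem (hP.mul_mem _ ha _ (interior_subset (hN n hn)))
  simpa [mul_sub] using h

lemma CSeq.const_eq_zero (hP : IsCone P) (hsolid : (interior P).Nonempty) {a : A} (ha : a ∈ P)
    (h : CSeq P fun _ => a) : a = 0 := by
  obtain ⟨e, he⟩ := hsolid
  refine hP.antisymm a ha ?_
  have hcont : Continuous fun r : ℝ => r • e - a := by fun_prop
  have hlim : Tendsto (fun r : ℝ => r • e - a) (𝓝[>] 0) (𝓝 (-a)) := by
    simpa using (hcont.tendsto 0).mono_left nhdsWithin_le_nhds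
  refine hP.closed.mem_of_tendsto hlim ?_
  filter_upwards [self_mem_nhdsWithin] with r hr
  obtain ⟨N, hN⟩ := h _ (hP.smul_mem_interior hr he)
  exact interior_subset (hN N le_rfl)

lemma IsCone.pow_mem (hP : IsCone P) {a : A} (ha : a ∈ P) (n : ℕ) : a ^ n ∈ P := by
  induction n with
  | zero => simpa using hP.one_mem
  | succ n ih => simpa [pow_succ] using hP.mul_mem _ ih _ ha

lemma IsCone.sum_mem (hP : IsCone P) {ι : Type*} {s : Finset ι} {f : ι → A}
    (hf : ∀ i, f i ∈ P) : ∑ i ∈ s, f i ∈ P :=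
  Finset.sum_induction f (· ∈ P) (fun a b ha hb => hP.add_mem a ha b hb) hP.zero_mem
    fun i _ => hf i

/-- If `specRad k < 1` for `k` in the cone, then `1 - k` has a left inverse in the cone. -/
lemma IsCone.exists_mul_one_sub_eq_one [CompleteSpace A] (hP : IsCone P) {k : A} (hk : k ∈ P)
    (hρ : specRad k < 1) : ∃ l ∈ P, l * (1 - k) = 1 := by
  obtain ⟨m, hm⟩ := exists_norm_pow_lt_one_of_specRad_lt_one hρ
  refine ⟨(∑' j : ℕ, (k ^ m) ^ j) * ∑ i ∈ Finset.range m, k ^ i, hP.mul_mem _ ?_ _ ?_, ?_⟩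
  · exact hP.closed.mem_of_tendsto (summable_geometric_of_norm_lt_one hm).hasSum
      (Eventually.of_forall fun s => hP.sum_mem fun j => hP.pow_mem (hP.pow_mem hk m) j)
  · exact hP.sum_mem fun i => hP.pow_mem hk i
  · rw [mul_assoc, geom_sum_mul_neg, geom_series_mul_neg _ hm]

end ConeLemmas

/-- Suppose the family `(T n)` has property (G) with (G)-limit `T∞`, each `T n` is a
`k`-contraction and has a fixed point `x n`.  Then `T∞` has a fixed point in `X∞` if and only
if the sequence `(x n)` converges to some point of `X∞` in the sense of the Banach algebra. -/
theorem gLimit_fixedPoint_iff_convergence {A : Type*} [NormedRing A] [NormedAlgebra ℝ A]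
    [CompleteSpace A] {X : Type*} (P : Set A) (hP : IsCone P) (hsolid : (interior P).Nonempty)
    (d : X → X → A) (hd : IsConeMetric P d)
    (Xn : ℕ → Set X) (hXn : ∀ n, (Xn n).Nonempty) (Xinf : Set X) (hXinf : Xinf.Nonempty)
    (T : ℕ → X → X) (Tinf : X → X)
    (hG : GLimit P d Xn Xinf T Tinf)
    (k : A) (hk : k ∈ P) (hρ : specRad k < 1)
    (hcontr : ∀ n, ∀ x ∈ Xn n, ∀ y ∈ Xn n, k * d x y - d (T n x) (T n y) ∈ P)
    (x : ℕ → X) (hx : ∀ n, x n ∈ Xn n) (hfix : ∀ n, T n (x n) = x n) :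
    (∃ xinf ∈ Xinf, Tinf xinf = xinf) ↔ ∃ y ∈ Xinf, CSeq P fun n => d (x n) y := by
  have hcomp : ∀ u : ℕ → X, (∀ n, u n ∈ Xn n) → ∀ y n,
      k * d (x n) y + k * d (u n) y - d (x n) (T n (u n)) ∈ P := fun u hu y n => by
    have h₁ := hcontr n _ (hx n) _ (hu n)
    have h₂ := hP.mul_mem _ hk _ (hd.triangle (x n) y (u n))
    rw [hfix, hd.symm y (u n)] at *
    convert hP.add_mem _ h₁ _ h₂ using 1
    noncomm_ring
  constructor
  · rintro ⟨y, hy, hTy⟩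
    obtain ⟨u, hu, huy, hTu⟩ := hG y hy
    rw [hTy] at hTu
    obtain ⟨l, hl, hlk⟩ := hP.exists_mul_one_sub_eq_one hk hρ
    refine ⟨y, hy, (((huy.const_mul hP hsolid hk).add hP hTu).const_mul hP hsolid hl).of_le hP
      fun n => ?_⟩
    have h := hP.mul_mem _ hl _ (hP.add_mem _ (hcomp u hu y n) _
      (hd.triangle (x n) (T n (u n)) y))
    convert h using 1
    calc l * (k * d (u n) y + d (T n (u n)) y) - d (x n) y
        = l * (k * d (u n) y + d (T n (u n)) y) - l * (1 - k) * d (x n) y := by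
          rw [hlk, one_mul]
      _ = _ := by noncomm_ring
  · rintro ⟨y, hy, hxy⟩
    obtain ⟨u, hu, huy, hTu⟩ := hG y hy
    refine ⟨y, hy, ((hd.eq_zero_iff _ _).1 (CSeq.const_eq_zero hP hsolid
      (hd.mem_cone y (Tinf y)) ?_)).symm⟩
    refine ((hxy.add hP ((hxy.const_mul hP hsolid hk).add hP
      (huy.const_mul hP hsolid hk))).add hP hTu).of_le hP fun n => ?_
    have h := hP.add_mem _ (hcomp u hu y n) _ (hP.add_mem _ (hd.triangle y (x n) (Tinf y)) _
      (hd.triangle (x n) (T n (u n)) (Tinf y)))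
    rw [hd.symm y (x n)] at h
    convert h using 1
    abel
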